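/- arXiv:2603.03720 — 2 statements merged into one kernel-verified Lean document; each statement's English description precedes it below -/
import Mathlib

section
/- For every R > 0 and every s ∈ ℂ, one has 1/Γ(s) = (1/(2πi)) · I_R(z ↦ e^z z^{-s}), where z^{-s} = exp(-s Log z) is the principal branch of the complex power (with Log the principal logarithm, arg z ∈ (-π, π]) and Γ is the complex Gamma function (with 1/Γ(s) = 0 at the poles of Γ). -/
open MeasureTheory

/-- The contour integral of `f` over the contour `γ(R, 3π/4)` consisting of the ray
`arg ζ = -3π/4, |ζ| ≥ R` traversed inward, the arc `|ζ| = R, -3π/4 ≤ arg ζ ≤ 3π/4`,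
and the ray `arg ζ = 3π/4, |ζ| ≥ R` traversed outward. -/
noncomputable def contourI (R : ℝ) (f : ℂ → ℂ) : ℂ :=
  -Complex.exp (-(3 * Real.pi / 4) * Complex.I) *
      (∫ r in Set.Ioi R, f (r * Complex.exp (-(3 * Real.pi / 4) * Complex.I))) +
    Complex.I * R *
      (∫ t in (-(3 * Real.pi / 4))..(3 * Real.pi / 4),
        Complex.exp (t * Complex.I) * f (R * Complex.exp (t * Complex.I))) +
    Complex.exp ((3 * Real.pi / 4) * Complex.I) *
      (∫ r in Set.Ioi R, f (r * Complex.exp ((3 * Real.pi / 4) * Complex.I)))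

open Filter Topology Set

/-- The integrand after the substitution `z = exp w`. -/
noncomputable def hkF (s w : ℂ) : ℂ := Complex.exp (Complex.exp w) * Complex.exp ((1 - s) * w)

noncomputable def hkRay (s : ℂ) (a θ : ℝ) : ℂ := ∫ x in Ioi a, hkF s (x + θ * Complex.I)

noncomputable def hkArc (s : ℂ) (a c d : ℝ) : ℂ := ∫ t in c..d, hkF s (a + t * Complex.I)

noncomputable def hkJ (s : ℂ) (a θ : ℝ) : ℂ :=
  -hkRay s a (-θ) + Complex.I * hkArc s a (-θ) θ + hkRay s a θ

lemma hkF_diff (s : ℂ) : Differentiable ℂ (hkF s) := by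
  unfold hkF
  fun_prop

lemma hkF_cont (s : ℂ) : Continuous (hkF s) := (hkF_diff s).continuous

lemma hkF_norm (s : ℂ) (x θ : ℝ) : ‖hkF s (x + θ * Complex.I)‖ =
    Real.exp (Real.exp x * Real.cos θ + ((1 - s.re) * x + s.im * θ)) := by
  unfold hkF
  rw [norm_mul, Complex.norm_exp, Complex.norm_exp, ← Real.exp_add]
  congr 1
  simp [Complex.exp_re]

lemma hkF_bound (s : ℂ) (x θ : ℝ) (hx : 0 ≤ x) (hc : Real.cos θ ≤ -1/2) (hθ : |θ| ≤ Real.pi) :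
    ‖hkF s (x + θ * Complex.I)‖ ≤
      Real.exp ((2 - s.re)^2 + |s.im| * Real.pi) * Real.exp (-x) := by
  rw [hkF_norm, ← Real.exp_add]
  apply Real.exp_le_exp.2
  have h1 : s.im * θ ≤ |s.im| * Real.pi := by
    calc s.im * θ ≤ |s.im * θ| := le_abs_self _
      _ = |s.im| * |θ| := abs_mul _ _
      _ ≤ _ := by gcongr
  have h2 : x^2/2 ≤ Real.exp x := by
    have := Real.quadratic_le_exp_of_nonneg hx
    nlinarith
  have h3 : Real.exp x * Real.cos θ ≤ Real.exp x * (-1/2) := by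
    gcongr
  nlinarith [sq_nonneg (x/2 - (2 - s.re))]

lemma hkF_integrable (s : ℂ) (a θ : ℝ) (hc : Real.cos θ ≤ -1/2) (hθ : |θ| ≤ Real.pi) :
    IntegrableOn (fun x : ℝ => hkF s (x + θ * Complex.I)) (Ioi a) := by
  have hcont : Continuous (fun x : ℝ => hkF s (x + θ * Complex.I)) :=
    (hkF_cont s).comp (by fun_prop)
  rw [IntegrableOn, ← integrable_norm_iff hcont.aestronglyMeasurable]
  apply integrable_of_isBigO_exp_neg (b := 1) one_pos hcont.norm.continuousOn
  apply Asymptotics.IsBigO.of_bound (Real.exp ((2 - s.re)^2 + |s.im| * Real.pi))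
  filter_upwards [eventually_ge_atTop 0] with x hx
  have := hkF_bound s x θ hx hc hθ
  simpa using this

lemma hkF_tendsto (s : ℂ) (θ : ℝ) (hc : Real.cos θ ≤ -1/2) (hθ : |θ| ≤ Real.pi) :
    Tendsto (fun x : ℝ => hkF s (x + θ * Complex.I)) atTop (𝓝 0) := by
  apply squeeze_zero_norm' (a := fun x : ℝ =>
    Real.exp ((2 - s.re)^2 + |s.im| * Real.pi) * Real.exp (-x))
  · filter_upwards [eventually_ge_atTop 0] with x hx using hkF_bound s x θ hx hc hθ
  · simpa using (Real.tendsto_exp_neg_atTop_nhds_zero).const_mul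
      (Real.exp ((2 - s.re)^2 + |s.im| * Real.pi))

lemma hk_rect (s : ℂ) (a b c d : ℝ) :
    (∫ x in a..b, hkF s (x + c * Complex.I)) - (∫ x in a..b, hkF s (x + d * Complex.I))
      + Complex.I * hkArc s b c d - Complex.I * hkArc s a c d = 0 := by
  have := Complex.integral_boundary_rect_eq_zero_of_differentiableOn (hkF s) (a + c * Complex.I)
    (b + d * Complex.I) (hkF_diff s).differentiableOn
  simpa [hkArc] using this

lemma hk_rot (s : ℂ) (a c d : ℝ)
    (h : ∀ θ ∈ uIcc c d, Real.cos θ ≤ -1/2 ∧ |θ| ≤ Real.pi) :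
    hkRay s a c - hkRay s a d = Complex.I * hkArc s a c d := by
  have hc := h c left_mem_uIcc
  have hd := h d right_mem_uIcc
  have t1 := intervalIntegral_tendsto_integral_Ioi a (hkF_integrable s a c hc.1 hc.2) tendsto_id
  have t2 := intervalIntegral_tendsto_integral_Ioi a (hkF_integrable s a d hd.1 hd.2) tendsto_id
  have t3 : Tendsto (fun b : ℝ => hkArc s b c d) atTop (𝓝 0) := by
    apply squeeze_zero_norm' (a := fun x : ℝ =>
      Real.exp ((2 - s.re)^2 + |s.im| * Real.pi) * Real.exp (-x) * |d - c|)
    · filter_upwards [eventually_ge_atTop 0] with x hx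
      apply intervalIntegral.norm_integral_le_of_norm_le_const
      intro t ht
      have := h t (uIoc_subset_uIcc ht)
      exact hkF_bound s x t hx this.1 this.2
    · simpa using ((Real.tendsto_exp_neg_atTop_nhds_zero).const_mul
        (Real.exp ((2 - s.re)^2 + |s.im| * Real.pi))).mul_const |d - c|
  have t4 := ((t1.sub t2).add (t3.const_mul Complex.I)).sub_const (Complex.I * hkArc s a c d)
  have t5 := tendsto_nhds_unique t4 (tendsto_const_nhds.congr (fun b => (hk_rect s a b c d).symm))
  unfold hkRay
  linear_combination t5

lemma hk_cos (θ : ℝ) (h1 : 3 * Real.pi / 4 ≤ θ) (h2 : θ ≤ Real.pi) : Real.cos θ ≤ -1/2 := by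
  have hp := Real.pi_pos
  have : Real.cos (Real.pi - Real.pi / 3) = -1/2 := by
    rw [Real.cos_pi_sub, Real.cos_pi_div_three]; norm_num
  rw [← this]
  apply Real.cos_le_cos_of_nonneg_of_le_pi <;> linarith

lemma hk_arc_intble (s : ℂ) (a c d : ℝ) :
    IntervalIntegrable (fun t : ℝ => hkF s (a + t * Complex.I)) volume c d :=
  ((hkF_cont s).comp (by fun_prop)).intervalIntegrable _ _

lemma hkJ_rot (s : ℂ) (a : ℝ) : hkJ s a (3 * Real.pi / 4) = hkJ s a Real.pi := by
  have hp := Real.pi_pos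
  have h1 := hk_rot s a (3 * Real.pi / 4) Real.pi (by
    intro θ hθ
    rw [uIcc_of_le (by linarith)] at hθ
    exact ⟨hk_cos θ hθ.1 hθ.2, abs_le.2 ⟨by linarith [hθ.1], hθ.2⟩⟩)
  have h2 := hk_rot s a (-Real.pi) (-(3 * Real.pi / 4)) (by
    intro θ hθ
    rw [uIcc_of_le (by linarith)] at hθ
    refine ⟨?_, abs_le.2 ⟨hθ.1, by linarith [hθ.2]⟩⟩
    rw [← Real.cos_neg]
    exact hk_cos (-θ) (by linarith [hθ.2]) (by linarith [hθ.1]))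
  have h3 : hkArc s a (-Real.pi) Real.pi = hkArc s a (-Real.pi) (-(3 * Real.pi / 4)) +
      hkArc s a (-(3 * Real.pi / 4)) (3 * Real.pi / 4) + hkArc s a (3 * Real.pi / 4) Real.pi := by
    unfold hkArc
    rw [intervalIntegral.integral_add_adjacent_intervals (hk_arc_intble s a _ _)
      (hk_arc_intble s a _ _), intervalIntegral.integral_add_adjacent_intervals
      (hk_arc_intble s a _ _) (hk_arc_intble s a _ _)]
  unfold hkJ
  rw [h3]
  linear_combination h1 + h2

lemma hk_pi : Real.cos Real.pi ≤ -1/2 ∧ |Real.pi| ≤ Real.pi := by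
  rw [Real.cos_pi, abs_of_pos Real.pi_pos]; norm_num

lemma hk_neg_pi : Real.cos (-Real.pi) ≤ -1/2 ∧ |-Real.pi| ≤ Real.pi := by
  rw [Real.cos_neg, abs_neg]; exact hk_pi

lemma hkJ_shift (s : ℂ) (a b : ℝ) (hab : a ≤ b) : hkJ s a Real.pi = hkJ s b Real.pi := by
  have h := hk_rect s a b (-Real.pi) Real.pi
  rw [← intervalIntegral.integral_Ioi_sub_Ioi (hkF_integrable s a _ hk_pi.1 hk_pi.2) hab,
    ← intervalIntegral.integral_Ioi_sub_Ioi (hkF_integrable s a _ hk_neg_pi.1 hk_neg_pi.2) hab] at h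
  unfold hkJ hkRay
  linear_combination -h

/-- Recurrence. -/
lemma hkJ_rec (s : ℂ) (a : ℝ) : hkJ s a Real.pi = s * hkJ (s + 1) a Real.pi := by
  have hder : ∀ w, HasDerivAt (hkF (s + 1)) (hkF s w - s * hkF (s + 1) w) w := by
    intro w
    unfold hkF
    have h1 : HasDerivAt (fun w => Complex.exp (Complex.exp w))
      (Complex.exp (Complex.exp w) * Complex.exp w) w := (Complex.hasDerivAt_exp w).cexp
    have h2 : HasDerivAt (fun w => Complex.exp ((1 - (s + 1)) * w))
      (Complex.exp ((1 - (s + 1)) * w) * ((1 - (s + 1)) * 1)) w :=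
      ((hasDerivAt_id w).const_mul _).cexp
    refine (h1.mul h2).congr_deriv ?_
    have : (1 - s) * w = w + (1 - (s + 1)) * w := by ring
    rw [this, Complex.exp_add]
    ring
  have hray : ∀ θ : ℝ, Real.cos θ ≤ -1/2 ∧ |θ| ≤ Real.pi →
      hkRay s a θ - s * hkRay (s + 1) a θ = - hkF (s + 1) (a + θ * Complex.I) := by
    intro θ hθ
    have i1 := hkF_integrable s a θ hθ.1 hθ.2
    have i2 := (hkF_integrable (s + 1) a θ hθ.1 hθ.2).const_mul s
    have := integral_Ioi_of_hasDerivAt_of_tendsto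
      (f := fun x : ℝ => hkF (s + 1) (x + θ * Complex.I))
      (f' := fun x : ℝ => hkF s (x + θ * Complex.I) - s * hkF (s + 1) (x + θ * Complex.I))
      (a := a) (m := 0) ((hkF_cont _).comp (by fun_prop)).continuousWithinAt
      (by
        intro x _
        have h1 : HasDerivAt (fun x : ℝ => (x : ℂ) + θ * Complex.I) 1 x :=
          (Complex.ofRealCLM.hasDerivAt (x := x)).add_const _
        have := (hder (x + θ * Complex.I)).comp x h1
        rw [mul_one] at this
        exact this)
      (i1.sub i2) (hkF_tendsto _ _ hθ.1 hθ.2)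
    rw [integral_sub i1 i2, integral_const_mul] at this
    unfold hkRay
    rw [this]; ring
  have harc : Complex.I * (hkArc s a (-Real.pi) Real.pi - s * hkArc (s + 1) a (-Real.pi) Real.pi)
      = hkF (s + 1) (a + Real.pi * Complex.I) - hkF (s + 1) (a + (-Real.pi : ℝ) * Complex.I) := by
    have i1 := hk_arc_intble s a (-Real.pi) Real.pi
    have i2 := (hk_arc_intble (s + 1) a (-Real.pi) Real.pi).const_mul s
    have := intervalIntegral.integral_eq_sub_of_hasDerivAt (a := -Real.pi) (b := Real.pi)
      (f := fun t : ℝ => hkF (s + 1) (a + t * Complex.I))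
      (f' := fun t : ℝ => Complex.I * (hkF s (a + t * Complex.I) -
        s * hkF (s + 1) (a + t * Complex.I)))
      (by
        intro x _
        have h1 : HasDerivAt (fun x : ℝ => (a : ℂ) + x * Complex.I) Complex.I x := by
          simpa using ((Complex.ofRealCLM.hasDerivAt (x := x)).mul_const Complex.I).const_add (a : ℂ)
        have := (hder (a + x * Complex.I)).comp x h1
        rw [mul_comm] at this
        exact this)
      ((i1.sub i2).const_mul _)
    rw [intervalIntegral.integral_const_mul, intervalIntegral.integral_sub i1 i2,
      intervalIntegral.integral_const_mul] at this
    exact this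
  have r1 := hray _ hk_pi
  have r2 := hray _ hk_neg_pi
  unfold hkJ
  linear_combination r1 - r2 + harc

lemma hkF_exp_shift (x : ℝ) : hkF 1 (x + (-Real.pi : ℝ) * Complex.I) =
    hkF 1 (x + (Real.pi : ℝ) * Complex.I) := by
  unfold hkF
  have : (x : ℂ) + (Real.pi : ℝ) * Complex.I
    = (x + (-Real.pi : ℝ) * Complex.I) + 2 * Real.pi * Complex.I := by push_cast; ring
  rw [this, Complex.exp_periodic]
  simp

lemma hkJ_one (a : ℝ) : hkJ 1 a Real.pi = 2 * Real.pi * Complex.I := by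
  have h1 : hkRay 1 a (-Real.pi) = hkRay 1 a Real.pi := by
    unfold hkRay
    simp_rw [hkF_exp_shift]
  have h2 : hkArc 1 a (-Real.pi) Real.pi = 2 * Real.pi := by
    have hav := DiffContOnCl.circleAverage (f := Complex.exp) (c := 0) (R := Real.exp a)
      Complex.differentiable_exp.diffContOnCl
    have hper : Function.Periodic (fun t : ℝ => Complex.exp (circleMap 0 (Real.exp a) t))
      (2 * Real.pi) := (periodic_circleMap 0 (Real.exp a)).comp Complex.exp
    have hp := hper.intervalIntegral_add_eq (-Real.pi) 0
    rw [Real.circleAverage_def, ← zero_add (2 * Real.pi), ← hp] at hav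
    have e : -Real.pi + 2 * Real.pi = Real.pi := by ring
    rw [e] at hav
    have e2 : hkArc 1 a (-Real.pi) Real.pi =
        ∫ t in (-Real.pi)..Real.pi, Complex.exp (circleMap 0 (Real.exp a) t) := by
      unfold hkArc
      congr 1
      ext t
      simp [hkF, circleMap, Complex.exp_add]
    rw [e2]
    have hpi : (Real.pi : ℂ) ≠ 0 := by exact_mod_cast Real.pi_ne_zero
    rw [Complex.real_smul, Complex.exp_zero] at hav
    push_cast at hav
    rw [zero_add] at hav
    field_simp at hav
    linear_combination hav
  unfold hkJ
  rw [h1, h2]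
  ring

lemma hk_full (s : ℂ) (hs : s.re < 1) :
    Integrable (fun x : ℝ => Complex.exp (-Complex.exp x) * Complex.exp ((1 - s) * x)) ∧
    ∫ x : ℝ, Complex.exp (-Complex.exp x) * Complex.exp ((1 - s) * x) = Complex.Gamma (1 - s) := by
  have hre : 0 < (1 - s).re := by simpa using hs
  have himg : Real.exp '' univ = Ioi 0 := by rw [image_univ, Real.range_exp]
  have hd : ∀ x ∈ (univ : Set ℝ), HasDerivWithinAt Real.exp (Real.exp x) univ x :=
    fun x _ => (Real.hasDerivAt_exp x).hasDerivWithinAt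
  have key : (fun x : ℝ => |Real.exp x| • ((Real.exp (-Real.exp x) : ℂ) *
      ((Real.exp x : ℝ) : ℂ) ^ ((1 - s) - 1))) =
      fun x : ℝ => Complex.exp (-Complex.exp x) * Complex.exp ((1 - s) * x) := by
    ext x
    have hx : ((Real.exp x : ℝ) : ℂ) ≠ 0 := by exact_mod_cast (Real.exp_pos x).ne'
    rw [abs_of_pos (Real.exp_pos x), Complex.real_smul, Complex.cpow_def_of_ne_zero hx,
      ← Complex.ofReal_log (Real.exp_pos x).le, Real.log_exp]
    push_cast
    rw [mul_left_comm, ← Complex.exp_add]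
    congr 2
    ring
  have hI := Complex.GammaIntegral_convergent hre
  have hG := Complex.Gamma_eq_integral hre
  unfold Complex.GammaIntegral at hG
  rw [← himg, integral_image_eq_integral_abs_deriv_smul MeasurableSet.univ hd
    Real.exp_injective.injOn, key, setIntegral_univ] at hG
  rw [← himg, integrableOn_image_iff_integrableOn_abs_deriv_smul MeasurableSet.univ hd
    Real.exp_injective.injOn, key, integrableOn_univ] at hI
  exact ⟨hI, hG.symm⟩

lemma hk_ray_pi (s : ℂ) (σ : ℝ) (hσ : Complex.exp (σ * Complex.I) = -1) (x : ℝ) :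
    hkF s (x + σ * Complex.I) = Complex.exp ((1 - s) * (σ * Complex.I)) *
      (Complex.exp (-Complex.exp x) * Complex.exp ((1 - s) * x)) := by
  unfold hkF
  rw [Complex.exp_add, hσ, mul_add, Complex.exp_add]
  ring_nf

lemma hk_ray_tendsto (s : ℂ) (hs : s.re < 1) (σ : ℝ) (hσ : Complex.exp (σ * Complex.I) = -1) :
    Tendsto (fun a => hkRay s a σ) atBot
      (𝓝 (Complex.exp ((1 - s) * (σ * Complex.I)) * Complex.Gamma (1 - s))) := by
  have h := hk_full s hs
  have t := (aecover_Ioi (μ := volume) (tendsto_id (α := ℝ)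
    (x := atBot))).integral_tendsto_of_countably_generated h.1
  rw [h.2] at t
  have := t.const_mul (Complex.exp ((1 - s) * (σ * Complex.I)))
  refine this.congr (fun a => ?_)
  unfold hkRay
  simp_rw [hk_ray_pi s σ hσ, integral_const_mul]
  rfl

lemma hk_arc_tendsto (s : ℂ) (hs : s.re < 1) :
    Tendsto (fun a => hkArc s a (-Real.pi) Real.pi) atBot (𝓝 0) := by
  have hp := Real.pi_pos
  apply squeeze_zero_norm' (a := fun x : ℝ =>
      Real.exp (1 + |s.im| * Real.pi) * Real.exp ((1 - s.re) * x) * |Real.pi - -Real.pi|)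
  · filter_upwards [eventually_le_atBot 0] with x hx
    apply intervalIntegral.norm_integral_le_of_norm_le_const
    intro t ht
    rw [uIoc_of_le (by linarith)] at ht
    have hθ : |t| ≤ Real.pi := abs_le.2 ⟨ht.1.le, ht.2⟩
    rw [hkF_norm, ← Real.exp_add]
    apply Real.exp_le_exp.2
    have h1 : s.im * t ≤ |s.im| * Real.pi := by
      calc s.im * t ≤ |s.im * t| := le_abs_self _
        _ = |s.im| * |t| := abs_mul _ _
        _ ≤ _ := by gcongr
    have h2 : Real.exp x * Real.cos t ≤ 1 := by
      have := Real.exp_le_one_iff.2 hx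
      have := Real.exp_pos x
      nlinarith [Real.cos_le_one t]
    linarith
  · have h1 : Tendsto (fun x : ℝ => (1 - s.re) * x) atBot atBot :=
      tendsto_id.const_mul_atBot (by linarith)
    simpa using ((Real.tendsto_exp_atBot.comp h1).const_mul
        (Real.exp (1 + |s.im| * Real.pi))).mul_const |Real.pi - -Real.pi|

lemma hkJ_base (s : ℂ) (hs : s.re < 1) (a : ℝ) :
    hkJ s a Real.pi = 2 * Real.pi * Complex.I * (Complex.Gamma s)⁻¹ := by
  have e1 : Complex.exp ((Real.pi : ℝ) * Complex.I) = -1 := Complex.exp_pi_mul_I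
  have e2 : Complex.exp ((-Real.pi : ℝ) * Complex.I) = -1 := by
    push_cast
    rw [neg_mul, Complex.exp_neg, Complex.exp_pi_mul_I]; norm_num
  have t := ((hk_ray_tendsto s hs _ e2).neg.add
    ((hk_arc_tendsto s hs).const_mul Complex.I)).add (hk_ray_tendsto s hs _ e1)
  have t2 : Tendsto (fun b => hkJ s b Real.pi) atBot (𝓝 (hkJ s a Real.pi)) := by
    apply tendsto_const_nhds.congr'
    filter_upwards [eventually_le_atBot a] with b hb using (hkJ_shift s b a hb).symm
  rw [tendsto_nhds_unique t2 t]
  have hG := Complex.Gamma_mul_Gamma_one_sub s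
  have hG1 : Complex.Gamma (1 - s) ≠ 0 := Complex.Gamma_ne_zero_of_re_pos (by simpa using hs)
  have hpi : (Real.pi : ℂ) ≠ 0 := by exact_mod_cast Real.pi_ne_zero
  have hsin : Complex.exp ((1 - s) * (Real.pi * Complex.I)) -
      Complex.exp ((1 - s) * ((-Real.pi : ℝ) * Complex.I)) =
        2 * Complex.I * Complex.sin (Real.pi * s) := by
    have f1 : (1 - s) * (Real.pi * Complex.I) = Real.pi * Complex.I + (-(Real.pi * s) * Complex.I) := by
      ring
    have f2 : (1 - s) * ((-Real.pi : ℝ) * Complex.I)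
      = (-Real.pi : ℝ) * Complex.I + ((Real.pi * s) * Complex.I) := by push_cast; ring
    rw [f1, f2, Complex.exp_add, Complex.exp_add, e2, e1, Complex.sin]
    linear_combination (Complex.exp (-(Real.pi * s) * Complex.I) -
      Complex.exp (Real.pi * s * Complex.I)) * (-Complex.I_sq)
  have hmain : Complex.sin (Real.pi * s) * Complex.Gamma (1 - s) =
      Real.pi * (Complex.Gamma s)⁻¹ := by
    by_cases h0 : Complex.Gamma s = 0
    · rw [h0, zero_mul, eq_comm, div_eq_zero_iff] at hG
      rw [h0, hG.resolve_left hpi]; simp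
    · have hs0 : Complex.sin (Real.pi * s) ≠ 0 := by
        intro h
        rw [h, div_zero] at hG
        exact (mul_ne_zero h0 hG1) hG
      rw [eq_div_iff hs0] at hG
      rw [← div_eq_mul_inv, eq_div_iff h0]
      linear_combination hG
  linear_combination Complex.Gamma (1 - s) * hsin + 2 * Complex.I * hmain

lemma hkJ_all (n : ℕ) : ∀ (s : ℂ), s.re < n + 1 → ∀ a : ℝ,
    hkJ s a Real.pi = 2 * Real.pi * Complex.I * (Complex.Gamma s)⁻¹ := by
  induction n with
  | zero => intro s hs a; exact hkJ_base s (by simpa using hs) a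
  | succ n ih =>
    intro s hs a
    by_cases h1 : s = 1
    · rw [h1, hkJ_one]; simp
    have hne : s - 1 ≠ 0 := sub_ne_zero.2 h1
    have h := ih (s - 1) (by push_cast at hs; simp; linarith) a
    rw [hkJ_rec, sub_add_cancel] at h
    have hg := Complex.Gamma_add_one (s - 1) hne
    rw [sub_add_cancel] at hg
    apply mul_left_cancel₀ hne
    rw [h, hg, mul_inv]
    field_simp

lemma hk_point (s : ℂ) (x t : ℝ) (h1 : -Real.pi < t) (h2 : t ≤ Real.pi) :
    Complex.exp (t * Complex.I) * Real.exp x *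
      (Complex.exp ((Real.exp x : ℝ) * Complex.exp (t * Complex.I)) *
        ((Real.exp x : ℝ) * Complex.exp (t * Complex.I)) ^ (-s)) = hkF s (x + t * Complex.I) := by
  have e : ((Real.exp x : ℝ) : ℂ) * Complex.exp (t * Complex.I)
      = Complex.exp (x + t * Complex.I) := by
    rw [Complex.exp_add]; push_cast; rfl
  have hl : Complex.log (Complex.exp (x + t * Complex.I)) = x + t * Complex.I :=
    Complex.log_exp (by simpa using h1) (by simpa using h2)
  rw [mul_comm (Complex.exp (t * Complex.I)), e,
    Complex.cpow_def_of_ne_zero (Complex.exp_ne_zero _), hl]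
  unfold hkF
  rw [mul_left_comm, ← Complex.exp_add]
  congr 2
  ring

lemma hk_ray_eq (s : ℂ) (a t : ℝ) (h1 : -Real.pi < t) (h2 : t ≤ Real.pi) :
    Complex.exp (t * Complex.I) * (∫ r in Ioi (Real.exp a),
      Complex.exp (r * Complex.exp (t * Complex.I)) * (r * Complex.exp (t * Complex.I)) ^ (-s)) =
    hkRay s a t := by
  have himg : Real.exp '' Ioi a = Ioi (Real.exp a) := by
    ext y
    constructor
    · rintro ⟨x, hx, rfl⟩
      exact Real.exp_lt_exp.2 hx
    · intro hy
      have hy0 : 0 < y := (Real.exp_pos a).trans hy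
      exact ⟨Real.log y, (Real.lt_log_iff_exp_lt hy0).2 hy, Real.exp_log hy0⟩
  have hd : ∀ x ∈ Ioi a, HasDerivWithinAt Real.exp (Real.exp x) (Ioi a) x :=
    fun x _ => (Real.hasDerivAt_exp x).hasDerivWithinAt
  rw [← himg, integral_image_eq_integral_abs_deriv_smul measurableSet_Ioi hd
    Real.exp_injective.injOn, ← integral_const_mul]
  unfold hkRay
  congr 1
  ext x
  rw [← hk_point s x t h1 h2, abs_of_pos (Real.exp_pos x), Complex.real_smul]
  ring

lemma hk_contour (s : ℂ) (a : ℝ) :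
    contourI (Real.exp a) (fun z => Complex.exp z * z ^ (-s)) = hkJ s a (3 * Real.pi / 4) := by
  have hp := Real.pi_pos
  have r1 := hk_ray_eq s a (3 * Real.pi / 4) (by linarith) (by linarith)
  have r2 := hk_ray_eq s a (-(3 * Real.pi / 4)) (by linarith) (by linarith)
  have harc : (Real.exp a : ℂ) * (∫ t in (-(3 * Real.pi / 4))..(3 * Real.pi / 4),
      Complex.exp (t * Complex.I) * (Complex.exp ((Real.exp a : ℝ) * Complex.exp (t * Complex.I)) *
        ((Real.exp a : ℝ) * Complex.exp (t * Complex.I)) ^ (-s)))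
      = hkArc s a (-(3 * Real.pi / 4)) (3 * Real.pi / 4) := by
    rw [← intervalIntegral.integral_const_mul]
    unfold hkArc
    apply intervalIntegral.integral_congr
    intro t ht
    rw [uIcc_of_le (by linarith)] at ht
    dsimp only
    rw [← hk_point s a t (by linarith [ht.1]) (by linarith [ht.2])]
    ring
  unfold contourI hkJ
  rw [← r1, ← r2, ← harc]
  push_cast
  ring

theorem stmt_1 (R : ℝ) (hR : 0 < R) (s : ℂ) :
    (Complex.Gamma s)⁻¹ =
      (1 / (2 * Real.pi * Complex.I)) * contourI R (fun z => Complex.exp z * z ^ (-s)) := by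
  obtain ⟨n, hn⟩ := exists_nat_gt s.re
  have h := hkJ_all n s (by linarith) (Real.log R)
  rw [← hkJ_rot, ← hk_contour, Real.exp_log hR] at h
  rw [h]
  have hpi : (Real.pi : ℂ) ≠ 0 := by exact_mod_cast Real.pi_ne_zero
  field_simp [Complex.I_ne_zero]
end

section
/- Let n ≥ 1 be an integer, R > 0, T > 0, and a_1, ..., a_n ≥ 0. Then ∫_{D^n_T} exp(-∑_{j=1}^n a_j u_j) du_1 ⋯ du_n = (T^n / (2πi)) · I_R(z ↦ (∏_{j=1}^n 1/(z + T a_j)) · e^z z^{-1}). -/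
open MeasureTheory

/-- The open simplex `D^n_T = {u ∈ ℝⁿ : uⱼ > 0 for all j, u₁ + ⋯ + uₙ < T}`. -/
def simplexD (n : ℕ) (T : ℝ) : Set (Fin n → ℝ) :=
  {u | (∀ j, 0 < u j) ∧ ∑ j, u j < T}

open Complex in
/-- The Cauchy theorem on a truncated annular sector. -/
lemma sector_finite (f : ℂ → ℂ) (R M θ₁ θ₂ : ℝ) (hR : 0 < R) (hM : R ≤ M) (hθ : θ₁ ≤ θ₂)
    (hf : ∀ r t : ℝ, R ≤ r → θ₁ ≤ t → t ≤ θ₂ → DifferentiableAt ℂ f (r * exp (t * I))) :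
    exp (θ₂ * I) * (∫ r in R..M, f (r * exp (θ₂ * I)))
      - exp (θ₁ * I) * (∫ r in R..M, f (r * exp (θ₁ * I)))
      + I * R * (∫ t in θ₁..θ₂, exp (t * I) * f (R * exp (t * I)))
      = I * M * (∫ t in θ₁..θ₂, exp (t * I) * f (M * exp (t * I))) := by
  have hM0 : 0 < M := hR.trans_le hM
  have hlog : Real.log R ≤ Real.log M := Real.log_le_log hR hM
  have key := Complex.integral_boundary_rect_eq_zero_of_differentiableOn
    (fun ζ => exp ζ * f (exp ζ)) ⟨Real.log R, θ₁⟩ ⟨Real.log M, θ₂⟩ (by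
      intro ζ hζ
      rw [mem_reProdIm] at hζ
      simp only [Set.uIcc_of_le hlog, Set.uIcc_of_le hθ, Set.mem_Icc] at hζ
      obtain ⟨⟨h1, h2⟩, h3, h4⟩ := hζ
      have e : exp ζ = (Real.exp ζ.re : ℝ) * exp (ζ.im * I) := by
        rw [ofReal_exp, ← Complex.exp_add, re_add_im]
      have hd := hf (Real.exp ζ.re) ζ.im ((Real.log_le_iff_le_exp hR).1 h1) h3 h4
      rw [← e] at hd
      exact (differentiableAt_exp.mul (hd.comp ζ differentiableAt_exp)).differentiableWithinAt)
  have ray : ∀ θ : ℝ, θ₁ ≤ θ → θ ≤ θ₂ →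
      (∫ x in Real.log R..Real.log M, exp (x + θ * I) * f (exp (x + θ * I)))
        = exp (θ * I) * ∫ r in R..M, f (r * exp (θ * I)) := by
    intro θ h1 h2
    have := intervalIntegral.integral_deriv_smul_comp' (a := Real.log R) (b := Real.log M)
      (f := Real.exp) (f' := Real.exp) (g := fun r : ℝ => f (r * exp (θ * I)))
      (fun x _ => Real.hasDerivAt_exp x) Real.continuous_exp.continuousOn (by
        rintro _ ⟨x, hx, rfl⟩
        rw [Set.uIcc_of_le hlog] at hx
        have hd := (hf (Real.exp x) θ ((Real.log_le_iff_le_exp hR).1 hx.1) h1 h2).continuousAt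
        have : ContinuousAt (fun r : ℝ => (r : ℂ) * exp (θ * I)) (Real.exp x) := by fun_prop
        exact (ContinuousAt.comp (f := fun r : ℝ => (r : ℂ) * exp (θ * I)) hd this).continuousWithinAt)
    rw [Real.exp_log hR, Real.exp_log hM0] at this
    rw [← this, ← intervalIntegral.integral_const_mul]
    congr 1
    ext x
    simp only [Function.comp, real_smul, Complex.exp_add, ofReal_exp]
    ring
  have arc : ∀ r : ℝ, 0 < r →
      (∫ y in θ₁..θ₂, exp ((Real.log r : ℝ) + y * I) * f (exp ((Real.log r : ℝ) + y * I)))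
        = r * ∫ t in θ₁..θ₂, exp (t * I) * f (r * exp (t * I)) := by
    intro r hr
    rw [← intervalIntegral.integral_const_mul]
    congr 1
    ext x
    rw [Complex.exp_add, ← ofReal_exp, Real.exp_log hr]
    ring
  simp only [smul_eq_mul] at key
  rw [ray θ₁ le_rfl hθ, ray θ₂ hθ le_rfl, arc R hR, arc M hM0] at key
  linear_combination -key

open Complex in
lemma ray_integrable (f : ℂ → ℂ) (R C θ : ℝ) (hR : 0 < R) (hf : Measurable f)
    (hC : ∀ r : ℝ, R ≤ r → ‖f (r * exp (θ * I))‖ ≤ C / r ^ 2) :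
    IntegrableOn (fun r : ℝ => f (r * exp (θ * I))) (Set.Ioi R) := by
  have h1 : IntegrableOn (fun r : ℝ => C * r ^ (-2 : ℝ)) (Set.Ioi R) :=
    (integrableOn_Ioi_rpow_of_lt (by norm_num) hR).const_mul C
  refine Integrable.mono' h1 (hf.comp (by fun_prop)).aestronglyMeasurable ?_
  filter_upwards [ae_restrict_mem measurableSet_Ioi] with r hr
  have hr' : R < r := hr
  refine (hC r hr'.le).trans_eq ?_
  rw [Real.rpow_neg (by linarith), div_eq_mul_inv]
  norm_num

open Complex Filter Topology in
/-- The Cauchy theorem on an infinite annular sector. -/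
lemma sector_infinite (f : ℂ → ℂ) (R C θ₁ θ₂ : ℝ) (hR : 0 < R) (hθ : θ₁ ≤ θ₂)
    (hfm : Measurable f)
    (hf : ∀ r t : ℝ, R ≤ r → θ₁ ≤ t → t ≤ θ₂ → DifferentiableAt ℂ f (r * exp (t * I)))
    (hC : ∀ r t : ℝ, R ≤ r → θ₁ ≤ t → t ≤ θ₂ → ‖f (r * exp (t * I))‖ ≤ C / r ^ 2) :
    exp (θ₂ * I) * (∫ r in Set.Ioi R, f (r * exp (θ₂ * I)))
      - exp (θ₁ * I) * (∫ r in Set.Ioi R, f (r * exp (θ₁ * I)))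
      + I * R * (∫ t in θ₁..θ₂, exp (t * I) * f (R * exp (t * I))) = 0 := by
  have i1 := intervalIntegral_tendsto_integral_Ioi R (ray_integrable f R C θ₁ hR hfm
    (fun r hr => hC r θ₁ hr le_rfl hθ)) tendsto_id
  have i2 := intervalIntegral_tendsto_integral_Ioi R (ray_integrable f R C θ₂ hR hfm
    (fun r hr => hC r θ₂ hr hθ le_rfl)) tendsto_id
  have lim := ((i2.const_mul (exp (θ₂ * I))).sub (i1.const_mul (exp (θ₁ * I)))).add_const
    (I * R * (∫ t in θ₁..θ₂, exp (t * I) * f (R * exp (t * I))))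
  refine tendsto_nhds_unique lim ?_
  have z : Tendsto (fun M : ℝ => C * |θ₂ - θ₁| * M⁻¹) atTop (𝓝 0) := by
    simpa using tendsto_inv_atTop_zero.const_mul (C * |θ₂ - θ₁|)
  refine squeeze_zero_norm' ?_ z
  filter_upwards [eventually_ge_atTop R] with M hM
  have hM0 : 0 < M := hR.trans_le hM
  have := sector_finite f R M θ₁ θ₂ hR hM hθ hf
  simp only [id]
  rw [this, norm_mul, norm_mul, norm_I, one_mul, norm_real, Real.norm_of_nonneg hM0.le]
  have b := intervalIntegral.norm_integral_le_of_norm_le_const (a := θ₁) (b := θ₂)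
    (f := fun t : ℝ => exp (t * I) * f (M * exp (t * I))) (C := C / M ^ 2) (by
      intro t ht
      rw [Set.uIoc_of_le hθ] at ht
      rw [norm_mul, norm_exp_ofReal_mul_I, one_mul]
      exact hC M t hM ht.1.le ht.2)
  refine (mul_le_mul_of_nonneg_left b hM0.le).trans_eq ?_
  field_simp

open Complex in
lemma contourI_eq (R : ℝ) (f : ℂ → ℂ) : contourI R f =
    -exp ((-(3 * Real.pi / 4) : ℝ) * I) *
      (∫ r in Set.Ioi R, f (r * exp ((-(3 * Real.pi / 4) : ℝ) * I))) +
    I * R * (∫ t in (-(3 * Real.pi / 4))..(3 * Real.pi / 4), exp (t * I) * f (R * exp (t * I))) +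
    exp ((3 * Real.pi / 4 : ℝ) * I) *
      (∫ r in Set.Ioi R, f (r * exp ((3 * Real.pi / 4 : ℝ) * I))) := by
  unfold contourI
  push_cast
  rfl

lemma cos_ge (t : ℝ) (h1 : -(3 * Real.pi / 4) ≤ t) (h2 : t ≤ 3 * Real.pi / 4) :
    -(3 / 4) ≤ Real.cos t := by
  have h : Real.cos (3 * Real.pi / 4) ≤ Real.cos |t| :=
    Real.cos_le_cos_of_nonneg_of_le_pi (abs_nonneg _) (by linarith [Real.pi_pos])
      (abs_le.2 ⟨h1, h2⟩)
  rw [Real.cos_abs, show 3 * Real.pi / 4 = Real.pi - Real.pi / 4 by ring, Real.cos_pi_sub,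
    Real.cos_pi_div_four] at h
  have : √2 ≤ 3 / 2 := by
    rw [Real.sqrt_le_left (by norm_num)]; norm_num
  linarith

lemma cos_three : Real.cos (3 * Real.pi / 4) ≤ -(1 / 2) := by
  rw [show 3 * Real.pi / 4 = Real.pi - Real.pi / 4 by ring, Real.cos_pi_sub,
    Real.cos_pi_div_four]
  have : 1 ≤ √2 := by
    rw [Real.one_le_sqrt]; norm_num
  linarith

lemma cos_left (t : ℝ) (h1 : 3 * Real.pi / 4 ≤ t) (h2 : t ≤ 5 * Real.pi / 4) :
    Real.cos t ≤ -(1 / 2) := by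
  have h : Real.cos (Real.pi / 4) ≤ Real.cos |t - Real.pi| :=
    Real.cos_le_cos_of_nonneg_of_le_pi (abs_nonneg _) (by linarith [Real.pi_pos])
      (abs_le.2 ⟨by linarith, by linarith⟩)
  rw [Real.cos_abs, Real.cos_sub_pi, Real.cos_pi_div_four] at h
  have : 1 ≤ √2 := by
    rw [Real.one_le_sqrt]; norm_num
  linarith

open Complex in
lemma inv_bound (r t a : ℝ) (hr : 0 < r) (ha : 0 ≤ a)
    (h1 : -(3 * Real.pi / 4) ≤ t) (h2 : t ≤ 3 * Real.pi / 4) :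
    (r * exp (t * I) + a ≠ 0) ∧ ‖(r * exp (t * I) + a)⁻¹‖ ≤ 2 / r := by
  have hc := cos_ge t h1 h2
  have hn : r / 2 ≤ ‖(r * exp (t * I) + a : ℂ)‖ := by
    refine (sq_le_sq₀ (by positivity) (norm_nonneg _)).1 ?_
    rw [← normSq_eq_norm_sq, normSq_apply]
    have e1 : (r * exp (t * I) + a : ℂ).re = r * Real.cos t + a := by
      simp [exp_ofReal_mul_I_re]
    have e2 : (r * exp (t * I) + a : ℂ).im = r * Real.sin t := by
      simp [exp_ofReal_mul_I_im]
    rw [e1, e2]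
    have := Real.sin_sq_add_cos_sq t
    have h3 : 0 ≤ r * a * (Real.cos t + 3 / 4) := by
      apply mul_nonneg (by positivity); linarith
    nlinarith [sq_nonneg (a - 3 / 4 * r), sq_nonneg r]
  have h0 : 0 < ‖(r * exp (t * I) + a : ℂ)‖ := lt_of_lt_of_le (by positivity) hn
  refine ⟨norm_pos_iff.1 h0, ?_⟩
  rw [norm_inv, ← inv_div]
  exact inv_anti₀ (by positivity) hn

open Complex in
/-- The case `n = 0`. -/
lemma contour_zero (R T : ℝ) (hR : 0 < R) (hT : 0 < T) :
    contourI R (fun w => exp (T * w) * w⁻¹) = 2 * Real.pi * I := by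
  set f : ℂ → ℂ := fun w => exp (T * w) * w⁻¹ with hf
  have hfm : Measurable f := by fun_prop
  have hpi := Real.pi_pos
  have hne : ∀ r t : ℝ, R ≤ r → (r * exp (t * I) : ℂ) ≠ 0 := fun r t hr =>
    mul_ne_zero (by exact_mod_cast (hR.trans_le hr).ne') (exp_ne_zero _)
  have hs := sector_infinite f R (2 / T) (3 * Real.pi / 4) (5 * Real.pi / 4) hR (by linarith) hfm
    (by
      intro r t hr _ _
      have := hne r t hr
      simp only [hf]
      fun_prop (disch := assumption))
    (by
      intro r t hr h1 h2
      have hr0 : 0 < r := hR.trans_le hr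
      have hc := cos_left t h1 h2
      simp only [hf]
      rw [norm_mul, norm_inv, norm_mul, norm_exp_ofReal_mul_I, mul_one, norm_real,
        Real.norm_of_nonneg hr0.le, norm_exp]
      have e : (T * (r * exp (t * I)) : ℂ).re = T * r * Real.cos t := by
        simp [exp_ofReal_mul_I_re, mul_assoc]
      rw [e]
      have h3 : Real.exp (T * r * Real.cos t) ≤ Real.exp (-(T * r / 2)) := by
        apply Real.exp_le_exp.2
        nlinarith [mul_pos hT hr0]
      have h4 : Real.exp (-(T * r / 2)) ≤ (T * r / 2)⁻¹ := by
        rw [Real.exp_neg]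
        apply inv_anti₀ (by positivity)
        linarith [Real.add_one_le_exp (T * r / 2)]
      calc _ ≤ (T * r / 2)⁻¹ * r⁻¹ := by
            apply mul_le_mul_of_nonneg_right (h3.trans h4) (by positivity)
        _ = _ := by field_simp)
  have hexp : exp ((5 * Real.pi / 4 : ℝ) * I) = exp ((-(3 * Real.pi / 4) : ℝ) * I) := by
    rw [← exp_periodic ((-(3 * Real.pi / 4) : ℝ) * I)]
    congr 1
    push_cast
    ring
  rw [hexp] at hs
  have hcont : Continuous (fun t : ℝ => exp (t * I) * f (R * exp (t * I))) := by
    have : ∀ t : ℝ, (R * exp (t * I) : ℂ) ≠ 0 := fun t => hne R t le_rfl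
    simp only [hf]
    fun_prop (disch := assumption)
  have hadd := intervalIntegral.integral_add_adjacent_intervals
    (hcont.intervalIntegrable (μ := volume) (-(3 * Real.pi / 4)) (3 * Real.pi / 4))
    (hcont.intervalIntegrable (3 * Real.pi / 4) (5 * Real.pi / 4))
  have hper : Function.Periodic (fun t : ℝ => exp (t * I) * f (R * exp (t * I)))
      (2 * Real.pi) := by
    intro t
    have : exp ((t + 2 * Real.pi : ℝ) * I) = exp (t * I) := by
      rw [← exp_periodic (t * I)]
      congr 1
      push_cast
      ring
    simp only [this]
  have hp := hper.intervalIntegral_add_eq (-(3 * Real.pi / 4)) 0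
  rw [show -(3 * Real.pi / 4) + 2 * Real.pi = 5 * Real.pi / 4 by ring, zero_add] at hp
  have hcirc := DiffContOnCl.circleIntegral_sub_inv_smul (R := R) (c := 0) (w := 0)
    (f := fun w => exp (T * w))
    (Differentiable.diffContOnCl (by fun_prop)) (Metric.mem_ball_self hR)
  have hc2 : I * R * (∫ t in (0 : ℝ)..(2 * Real.pi), exp (t * I) * f (R * exp (t * I)))
      = 2 * Real.pi * I := by
    simp only [mul_zero, exp_zero, smul_eq_mul, mul_one] at hcirc
    rw [← hcirc, circleIntegral, ← intervalIntegral.integral_const_mul]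
    congr 1
    ext t
    simp only [deriv_circleMap, circleMap_zero, hf, sub_zero, smul_eq_mul]
    ring
  rw [contourI_eq, ← hc2, ← hp, ← hadd]
  linear_combination -hs

open Complex in
/-- Fubini on one piece of the contour. -/
lemma piece (μ : Measure ℝ) [SFinite μ] (p G : ℝ → ℂ) (hp : Measurable p) (hG : Measurable G)
    (a T : ℝ) (hT : 0 < T) (ha : 0 ≤ a) (k : ℝ → ℝ) (hk : Integrable k μ)
    (hb : ∀ᵐ x ∂μ, ∀ s : ℝ, 0 < s → s ≤ T →
      ‖G x‖ * Real.exp (s * (p x).re) ≤ k x * s ^ (-(1 / 2) : ℝ))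
    (hne : ∀ᵐ x ∂μ, p x + a ≠ 0) :
    IntegrableOn (fun s : ℝ => exp (-a * (T - s)) * ∫ x, G x * exp (s * p x) ∂μ) (Set.Ioc 0 T) ∧
    ∫ s in Set.Ioc 0 T, exp (-a * (T - s)) * ∫ x, G x * exp (s * p x) ∂μ
      = ∫ x, G x * ((exp (T * p x) - exp (-a * T)) * (p x + a)⁻¹) ∂μ := by
  set ν : Measure ℝ := volume.restrict (Set.Ioc 0 T) with hν
  have hs : Integrable (fun s : ℝ => s ^ (-(1 / 2) : ℝ)) ν :=
    (intervalIntegral.intervalIntegrable_rpow' (by norm_num) :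
      IntervalIntegrable (fun x : ℝ => x ^ (-(1 / 2) : ℝ)) volume 0 T).1
  have hint : Integrable (Function.uncurry fun (s : ℝ) (x : ℝ) =>
      exp (-a * (T - s)) * (G x * exp (s * p x))) (ν.prod μ) := by
    refine Integrable.mono' (hs.mul_prod hk) ?_ ?_
    · apply Measurable.aestronglyMeasurable
      unfold Function.uncurry
      fun_prop
    · have m1 : ∀ᵐ z ∂(ν.prod μ), z.1 ∈ Set.Ioc 0 T :=
        Measure.quasiMeasurePreserving_fst.ae (ae_restrict_mem measurableSet_Ioc)
      have m2 := (Measure.quasiMeasurePreserving_snd (μ := ν) (ν := μ)).ae hb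
      filter_upwards [m1, m2] with z h1 h2
      have h3 := h2 z.1 h1.1 h1.2
      simp only [Function.uncurry]
      rw [norm_mul, norm_mul, norm_exp, norm_exp, re_ofReal_mul]
      have e : (-a * (T - z.1) : ℂ).re = -(a * (T - z.1)) := by
        have : (-a * (T - z.1) : ℂ) = ((-(a * (T - z.1)) : ℝ) : ℂ) := by push_cast; ring
        rw [this, ofReal_re]
      rw [e]
      have h4 : Real.exp (-(a * (T - z.1))) ≤ 1 := by
        rw [Real.exp_le_one_iff]
        have := mul_nonneg ha (sub_nonneg.2 h1.2)
        linarith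
      calc _ ≤ 1 * (k z.2 * z.1 ^ (-(1 / 2) : ℝ)) := by
            apply mul_le_mul h4 h3 (by positivity) zero_le_one
        _ = _ := by ring
  have e1 : ∀ s : ℝ, exp (-a * (T - s)) * ∫ x, G x * exp (s * p x) ∂μ
      = ∫ x, exp (-a * (T - s)) * (G x * exp (s * p x)) ∂μ := fun s =>
    (integral_const_mul _ _).symm
  refine ⟨?_, ?_⟩
  · simp only [e1]
    exact hint.integral_prod_left
  · simp only [e1]
    rw [integral_integral_swap hint]
    apply integral_congr_ae
    filter_upwards [hne] with x hx
    have e2 : ∀ s : ℝ, exp (-a * (T - s)) * (G x * exp (s * p x))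
        = (G x * exp (-a * T)) * exp ((p x + a) * s) := by
      intro s
      rw [mul_left_comm, ← Complex.exp_add, mul_assoc, ← Complex.exp_add]
      ring_nf
    simp only [e2]
    rw [integral_const_mul, hν, ← intervalIntegral.integral_of_le hT.le,
      integral_exp_mul_complex hx]
    rw [mul_assoc, div_eq_mul_inv, ← mul_assoc (exp _), mul_sub, ← Complex.exp_add,
      ← Complex.exp_add]
    congr 4 <;> congr 1 <;> simp <;> ring

noncomputable def simpF (n : ℕ) (a : Fin n → ℝ) (T : ℝ) : ℝ :=
  ∫ u in simplexD n T, Real.exp (-∑ j, a j * u j)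

lemma simplexD_empty (n : ℕ) (T : ℝ) (hT : T ≤ 0) : simplexD n T = ∅ := by
  ext u
  simp only [simplexD, Set.mem_ofPred_eq, Set.mem_empty_iff_false, iff_false, not_and, not_lt]
  intro h
  exact hT.trans (Finset.sum_nonneg fun j _ => (h j).le)

lemma simplexD_measurable (n : ℕ) (T : ℝ) : MeasurableSet (simplexD n T) := by
  have : simplexD n T = (⋂ j, {u | 0 < u j}) ∩ {u | ∑ j, u j < T} := by
    ext u; simp [simplexD]
  rw [this]
  exact (MeasurableSet.iInter fun j => measurableSet_lt (by fun_prop) (by fun_prop)).inter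
    (measurableSet_lt (by fun_prop) (by fun_prop))

lemma simpF_zero (a : Fin 0 → ℝ) (T : ℝ) (hT : 0 < T) : simpF 0 a T = 1 := by
  have : simplexD 0 T = Set.univ := by
    ext u; simp [simplexD, hT]
  simp [simpF, this, Measure.real, volume_pi, Measure.pi_of_empty]

lemma simpF_succ (n : ℕ) (a : Fin (n + 1) → ℝ) (ha : ∀ j, 0 ≤ a j) (T : ℝ) (hT : 0 < T) :
    simpF (n + 1) a T =
      ∫ s in Set.Ioc 0 T, Real.exp (-a 0 * (T - s)) * simpF n (fun j => a j.succ) s := by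
  set S : Set (ℝ × (Fin n → ℝ)) := {q | 0 < q.1 ∧ q.2 ∈ simplexD n (T - q.1)} with hS
  set g : ℝ × (Fin n → ℝ) → ℝ := S.indicator
    (fun q => Real.exp (-a 0 * q.1) * Real.exp (-∑ j, a j.succ * q.2 j)) with hg
  have hSm : MeasurableSet S := by
    have : S = {q | 0 < q.1} ∩ ((⋂ j, {q | 0 < q.2 j}) ∩ {q | ∑ j, q.2 j < T - q.1}) := by
      ext u; simp [hS, simplexD]
    rw [this]
    exact (measurableSet_lt (by fun_prop) (by fun_prop)).inter
      ((MeasurableSet.iInter fun j => measurableSet_lt (by fun_prop) (by fun_prop)).inter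
      (measurableSet_lt (by fun_prop) (by fun_prop)))
  have hSfin : volume S < ⊤ := by
    have hsub : S ⊆ Set.Icc 0 (T, fun _ => T) := by
      rintro ⟨x, v⟩ ⟨h1, h2, h3⟩
      simp only at h1 h2 h3
      have hsum : 0 ≤ ∑ j, v j := Finset.sum_nonneg fun j _ => (h2 j).le
      refine ⟨⟨h1.le, fun j => (h2 j).le⟩, ⟨by simp only; linarith, fun j => ?_⟩⟩
      have := Finset.single_le_sum (f := v) (fun j _ => (h2 j).le) (Finset.mem_univ j)
      simp only
      linarith
    exact (measure_mono hsub).trans_lt isCompact_Icc.measure_lt_top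
  have hgi : Integrable g := by
    rw [hg, integrable_indicator_iff hSm]
    haveI : IsFiniteMeasure (volume.restrict S) := ⟨by simpa using hSfin⟩
    refine Integrable.of_bound (C := 1) (Measurable.aestronglyMeasurable (by fun_prop)) ?_
    filter_upwards [ae_restrict_mem hSm] with q hq
    rw [← Real.exp_add, Real.norm_of_nonneg (Real.exp_nonneg _), Real.exp_le_one_iff]
    have h1 := mul_nonneg (ha 0) hq.1.le
    have h2 : 0 ≤ ∑ j, a j.succ * q.2 j :=
      Finset.sum_nonneg fun j _ => mul_nonneg (ha _) (hq.2.1 j).le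
    linarith
  have hmp := volume_preserving_piFinSuccAbove (fun _ : Fin (n + 1) => ℝ) 0
  have step1 : simpF (n + 1) a T = ∫ q, g q := by
    rw [← hmp.integral_comp' g, simpF, ← integral_indicator (simplexD_measurable _ _)]
    congr 1
    ext u
    have hmem : u ∈ simplexD (n + 1) T ↔ MeasurableEquiv.piFinSuccAbove (fun _ => ℝ) 0 u ∈ S := by
      simp only [simplexD, hS, Set.mem_ofPred_eq, Fin.forall_fin_succ, Fin.sum_univ_succ,
        MeasurableEquiv.piFinSuccAbove_apply, Fin.insertNthEquiv, Equiv.coe_fn_symm_mk,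
        Fin.removeNth, Fin.zero_succAbove, and_assoc, lt_sub_iff_add_lt']
    by_cases h : u ∈ simplexD (n + 1) T
    · rw [Set.indicator_of_mem h, hg, Set.indicator_of_mem (hmem.1 h), ← Real.exp_add]
      congr 1
      simp only [Fin.sum_univ_succ, MeasurableEquiv.piFinSuccAbove_apply, Fin.insertNthEquiv,
        Equiv.coe_fn_symm_mk, Fin.removeNth, Fin.zero_succAbove]
      ring
    · rw [Set.indicator_of_notMem h, hg, Set.indicator_of_notMem (fun h' => h (hmem.2 h'))]
  have step2 : ∀ x : ℝ, ∫ v, g (x, v) = (Set.Ioc 0 T).indicator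
      (fun x => Real.exp (-a 0 * x) * simpF n (fun j => a j.succ) (T - x)) x := by
    intro x
    by_cases hx : x ∈ Set.Ioc 0 T
    · rw [Set.indicator_of_mem hx, simpF, ← integral_const_mul,
        ← integral_indicator (simplexD_measurable _ _)]
      congr 1
      ext v
      by_cases hv : v ∈ simplexD n (T - x)
      · rw [Set.indicator_of_mem hv, hg, Set.indicator_of_mem (show (x, v) ∈ S from ⟨hx.1, hv⟩)]
      · rw [Set.indicator_of_notMem hv, hg, Set.indicator_of_notMem (fun h => hv h.2)]
    · rw [Set.indicator_of_notMem hx]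
      have : ∀ v, g (x, v) = 0 := by
        intro v
        rw [hg, Set.indicator_of_notMem]
        rintro ⟨h1, h2⟩
        simp only at h1 h2
        have h3 : T < x := by
          by_contra h; exact hx ⟨h1, not_lt.1 h⟩
        rw [simplexD_empty n _ (by linarith)] at h2
        exact h2
      simp [this]
  rw [step1, Measure.volume_eq_prod, integral_prod _ (by rwa [← Measure.volume_eq_prod])]
  simp only [step2]
  rw [integral_indicator measurableSet_Ioc, ← intervalIntegral.integral_of_le hT.le,
    ← intervalIntegral.integral_of_le hT.le]
  have := intervalIntegral.integral_comp_sub_left (a := 0) (b := T)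
    (fun s => Real.exp (-a 0 * (T - s)) * simpF n (fun j => a j.succ) s) T
  simpa using this

lemma exp_neg_le_rpow (y : ℝ) (hy : 0 < y) : Real.exp (-y) ≤ y ^ (-(1 / 2) : ℝ) := by
  rw [Real.exp_neg, Real.rpow_neg hy.le, ← Real.sqrt_eq_rpow]
  apply inv_anti₀ (Real.sqrt_pos.2 hy)
  have h1 := Real.add_one_le_exp y
  have h2 : √y ≤ y + 1 := by
    rw [Real.sqrt_le_left (by linarith)]
    nlinarith
  linarith

open Complex in
lemma arc_integrable (f : ℂ → ℂ) (R C : ℝ) (hf : Measurable f)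
    (hC : ∀ t : ℝ, -(3 * Real.pi / 4) ≤ t → t ≤ 3 * Real.pi / 4 → ‖f (R * exp (t * I))‖ ≤ C) :
    IntervalIntegrable (fun t : ℝ => exp (t * I) * f (R * exp (t * I))) volume
      (-(3 * Real.pi / 4)) (3 * Real.pi / 4) := by
  rw [intervalIntegrable_iff_integrableOn_Ioc_of_le (by linarith [Real.pi_pos])]
  refine Integrable.of_bound (C := C) (Measurable.aestronglyMeasurable
    (Measurable.mul (by fun_prop) (hf.comp (by fun_prop)))) ?_
  filter_upwards [ae_restrict_mem measurableSet_Ioc] with t ht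
  rw [norm_mul, norm_exp_ofReal_mul_I, one_mul]
  exact hC t ht.1.le ht.2

open Complex in
lemma contourI_sub_mul (f g : ℂ → ℂ) (c : ℂ) (R : ℝ)
    (hf1 : IntegrableOn (fun r : ℝ => f (r * exp ((-(3 * Real.pi / 4) : ℝ) * I))) (Set.Ioi R))
    (hf2 : IntegrableOn (fun r : ℝ => f (r * exp ((3 * Real.pi / 4 : ℝ) * I))) (Set.Ioi R))
    (hf3 : IntervalIntegrable (fun t : ℝ => exp (t * I) * f (R * exp (t * I))) volume
      (-(3 * Real.pi / 4)) (3 * Real.pi / 4))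
    (hg1 : IntegrableOn (fun r : ℝ => g (r * exp ((-(3 * Real.pi / 4) : ℝ) * I))) (Set.Ioi R))
    (hg2 : IntegrableOn (fun r : ℝ => g (r * exp ((3 * Real.pi / 4 : ℝ) * I))) (Set.Ioi R))
    (hg3 : IntervalIntegrable (fun t : ℝ => exp (t * I) * g (R * exp (t * I))) volume
      (-(3 * Real.pi / 4)) (3 * Real.pi / 4)) :
    contourI R (fun w => f w - c * g w) = contourI R f - c * contourI R g := by
  simp only [contourI_eq]
  rw [integral_sub hf1 (hg1.const_mul c), integral_sub hf2 (hg2.const_mul c)]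
  have e : ∀ t : ℝ, exp (t * I) * (f (R * exp (t * I)) - c * g (R * exp (t * I)))
      = exp (t * I) * f (R * exp (t * I)) - c * (exp (t * I) * g (R * exp (t * I))) := by
    intro t; ring
  simp only [e]
  rw [intervalIntegral.integral_sub hf3 (hg3.const_mul c)]
  simp only [integral_const_mul, intervalIntegral.integral_const_mul]
  ring

lemma integral_comb (ν : Measure ℝ) (c₁ c₂ c₃ : ℂ) (f₁ f₂ f₃ : ℝ → ℂ) (h₁ : Integrable f₁ ν)
    (h₂ : Integrable f₂ ν) (h₃ : Integrable f₃ ν) :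
    ∫ s, (c₁ * f₁ s + c₂ * f₂ s + c₃ * f₃ s) ∂ν
      = c₁ * (∫ s, f₁ s ∂ν) + c₂ * (∫ s, f₂ s ∂ν) + c₃ * ∫ s, f₃ s ∂ν := by
  have h := (h₁.const_mul c₁).add (h₂.const_mul c₂)
  have e := integral_add h (h₃.const_mul c₃)
  simp only [Pi.add_apply] at e
  rw [e, integral_add (h₁.const_mul c₁) (h₂.const_mul c₂)]
  simp only [integral_const_mul]

open Complex in
lemma contour_main (R : ℝ) (hR : 0 < R) (n : ℕ) : ∀ (a : Fin n → ℝ), (∀ j, 0 ≤ a j) →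
    ∀ T : ℝ, 0 < T → (simpF n a T : ℂ) * (2 * Real.pi * I) =
      contourI R (fun w => (∏ j, (w + a j)⁻¹) * exp (T * w) * w⁻¹) := by
  induction n with
  | zero =>
    intro a _ T hT
    rw [simpF_zero a T hT]
    simp [contour_zero R T hR hT]
  | succ n ih =>
    intro a ha T hT
    have hpi := Real.pi_pos
    set g : ℂ → ℂ := fun w => (∏ j : Fin n, (w + a j.succ)⁻¹) * w⁻¹ with hg
    have hgm : Measurable g := by fun_prop
    set K : ℝ := (2 / R) ^ n with hK
    have hK0 : 0 ≤ K := by positivity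
    have hgb : ∀ r t : ℝ, R ≤ r → -(3 * Real.pi / 4) ≤ t → t ≤ 3 * Real.pi / 4 →
        ‖g (r * exp (t * I))‖ ≤ K * r⁻¹ := by
      intro r t hr h1 h2
      have hr0 := hR.trans_le hr
      simp only [hg]
      rw [norm_mul, norm_inv, norm_mul, norm_exp_ofReal_mul_I, mul_one, norm_real,
        Real.norm_of_nonneg hr0.le]
      apply mul_le_mul_of_nonneg_right _ (by positivity)
      rw [norm_prod, hK]
      calc _ ≤ ∏ j : Fin n, (2 / R) := by
            apply Finset.prod_le_prod (fun _ _ => norm_nonneg _)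
            intro j _
            exact (inv_bound r t _ hr0 (ha _) h1 h2).2.trans (by gcongr)
        _ = _ := by rw [Finset.prod_const, Finset.card_univ, Fintype.card_fin]
    have hgd : ∀ r t : ℝ, R ≤ r → -(3 * Real.pi / 4) ≤ t → t ≤ 3 * Real.pi / 4 →
        DifferentiableAt ℂ (fun w => g w * (w + a 0)⁻¹) (r * exp (t * I)) := by
      intro r t hr h1 h2
      have hr0 := hR.trans_le hr
      have q0 : (r * exp (t * I) : ℂ) ≠ 0 :=
        mul_ne_zero (by exact_mod_cast hr0.ne') (exp_ne_zero _)
      have q1 : ∀ j, (r * exp (t * I) + a j : ℂ) ≠ 0 := fun j =>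
        (inv_bound r t _ hr0 (ha j) h1 h2).1
      simp only [hg]
      refine DifferentiableAt.mul (DifferentiableAt.mul ?_ (differentiableAt_inv q0)) ?_
      · apply DifferentiableAt.fun_finsetProd
        intro j _
        exact DifferentiableAt.inv (by fun_prop) (q1 _)
      · exact DifferentiableAt.inv (by fun_prop) (q1 0)
    have hg2b : ∀ r t : ℝ, R ≤ r → -(3 * Real.pi / 4) ≤ t → t ≤ 3 * Real.pi / 4 →
        ‖g (r * exp (t * I)) * (r * exp (t * I) + a 0)⁻¹‖ ≤ (K * 2) / r ^ 2 := by
      intro r t hr h1 h2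
      have hr0 := hR.trans_le hr
      rw [norm_mul]
      calc _ ≤ (K * r⁻¹) * (2 / r) := mul_le_mul (hgb r t hr h1 h2)
            (inv_bound r t _ hr0 (ha 0) h1 h2).2 (norm_nonneg _) (by positivity)
        _ = _ := by field_simp
    -- the exponential factor
    have hre : ∀ s r t : ℝ, (s * (r * exp (t * I)) : ℂ).re = s * (r * Real.cos t) := by
      intro s r t
      rw [re_ofReal_mul, re_ofReal_mul, exp_ofReal_mul_I_re]
    have hvan : contourI R (fun w => g w * (w + a 0)⁻¹) = 0 := by
      have := sector_infinite (fun w => g w * (w + a 0)⁻¹) R (K * 2) (-(3 * Real.pi / 4))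
        (3 * Real.pi / 4) hR (by linarith) (by fun_prop) hgd hg2b
      rw [contourI_eq]
      linear_combination this
    set f1 : ℂ → ℂ := fun w => g w * (w + a 0)⁻¹ * exp (T * w) with hf1
    have hf1m : Measurable f1 := by fun_prop
    have hcosm : Real.cos (-(3 * Real.pi / 4)) ≤ -(1 / 2) := by
      rw [Real.cos_neg]; exact cos_three
    have hf1r : ∀ θ : ℝ, -(3 * Real.pi / 4) ≤ θ → θ ≤ 3 * Real.pi / 4 → Real.cos θ ≤ -(1 / 2) →
        IntegrableOn (fun r : ℝ => f1 (r * exp (θ * I))) (Set.Ioi R) := by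
      intro θ h1 h2 h3
      refine ray_integrable f1 R (K * 2) θ hR hf1m ?_
      intro r hr
      have hr0 := hR.trans_le hr
      simp only [hf1]
      rw [norm_mul, norm_exp, hre]
      have : Real.exp (T * (r * Real.cos θ)) ≤ 1 := by
        rw [Real.exp_le_one_iff]
        nlinarith [mul_pos hT hr0]
      calc _ ≤ (K * 2) / r ^ 2 * 1 := mul_le_mul (hg2b r θ hr h1 h2) this
            (Real.exp_nonneg _) (by positivity)
        _ = _ := mul_one _
    have hexpb : ∀ s t : ℝ, 0 < s → s ≤ T → Real.exp (s * (R * Real.cos t)) ≤ Real.exp (T * R) := by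
      intro s t h1 h2
      apply Real.exp_le_exp.2
      have : s * R ≤ T * R := by gcongr
      nlinarith [mul_pos h1 hR, Real.cos_le_one t]
    have hsplit : contourI R (fun w => f1 w - exp (-a 0 * T) * (g w * (w + a 0)⁻¹))
        = contourI R f1 - exp (-a 0 * T) * contourI R (fun w => g w * (w + a 0)⁻¹) := by
      apply contourI_sub_mul
      · exact hf1r _ le_rfl (by linarith) hcosm
      · exact hf1r _ (by linarith) le_rfl cos_three
      · refine arc_integrable f1 R ((K * 2) / R ^ 2 * Real.exp (T * R)) hf1m ?_
        intro t h1 h2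
        simp only [hf1]
        rw [norm_mul, norm_exp, hre]
        exact mul_le_mul (hg2b R t le_rfl h1 h2) (hexpb T t hT le_rfl)
            (Real.exp_nonneg _) (by positivity)
      · exact ray_integrable (fun w => g w * (w + a 0)⁻¹) R (K * 2) _ hR (by fun_prop)
          (fun r hr => hg2b r _ hr le_rfl (by linarith))
      · exact ray_integrable (fun w => g w * (w + a 0)⁻¹) R (K * 2) _ hR (by fun_prop)
          (fun r hr => hg2b r _ hr (by linarith) le_rfl)
      · exact arc_integrable (fun w => g w * (w + a 0)⁻¹) R ((K * 2) / R ^ 2) (by fun_prop)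
          (fun t h1 h2 => hg2b R t le_rfl h1 h2)
    have hray : ∀ θ : ℝ, -(3 * Real.pi / 4) ≤ θ → θ ≤ 3 * Real.pi / 4 → Real.cos θ ≤ -(1 / 2) →
        _ := fun θ h1 h2 h3 =>
      piece (volume.restrict (Set.Ioi R)) (fun r => r * exp (θ * I))
        (fun r => g (r * exp (θ * I))) (by fun_prop) (hgm.comp (by fun_prop)) (a 0) T hT (ha 0)
        (fun r => K * (1 / 2 : ℝ) ^ (-(1 / 2) : ℝ) * r ^ (-(3 / 2) : ℝ))
        ((integrableOn_Ioi_rpow_of_lt (by norm_num) hR).const_mul _)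
        (by
          filter_upwards [ae_restrict_mem measurableSet_Ioi] with r hr s hs0 hsT
          have hr' : R ≤ r := le_of_lt hr
          have hr0 := hR.trans_le hr'
          have e : ((r : ℂ) * exp (θ * I)).re = r * Real.cos θ := by
            rw [re_ofReal_mul, exp_ofReal_mul_I_re]
          rw [e]
          have h4 : Real.exp (s * (r * Real.cos θ)) ≤ (1 / 2 * r * s) ^ (-(1 / 2) : ℝ) := by
            refine le_trans (Real.exp_le_exp.2 ?_) (exp_neg_le_rpow (1 / 2 * r * s) (by positivity))
            nlinarith [mul_pos hs0 hr0]
          rw [Real.mul_rpow (by positivity) hs0.le, Real.mul_rpow (by norm_num) hr0.le] at h4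
          have h5 : r ^ (-(3 / 2) : ℝ) = r⁻¹ * r ^ (-(1 / 2) : ℝ) := by
            rw [← Real.rpow_neg_one, ← Real.rpow_add hr0]; norm_num
          rw [h5]
          calc _ ≤ (K * r⁻¹) * _ := mul_le_mul (hgb r θ hr' h1 h2) h4 (Real.exp_nonneg _)
                (by positivity)
            _ = _ := by ring)
        (by
          filter_upwards [ae_restrict_mem measurableSet_Ioi] with r hr
          exact (inv_bound r θ _ (hR.trans hr) (ha 0) h1 h2).1)
    obtain ⟨i1, e1⟩ := hray (-(3 * Real.pi / 4)) le_rfl (by linarith) hcosm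
    obtain ⟨i3, e3⟩ := hray (3 * Real.pi / 4) (by linarith) le_rfl cos_three
    obtain ⟨i2, e2⟩ := piece (volume.restrict (Set.Ioc (-(3 * Real.pi / 4)) (3 * Real.pi / 4)))
        (fun t => R * exp (t * I)) (fun t => exp (t * I) * g (R * exp (t * I))) (by fun_prop)
        (Measurable.mul (by fun_prop) (hgm.comp (by fun_prop))) (a 0) T hT (ha 0)
        (fun t => K * R⁻¹ * Real.exp (T * R) * (T ^ (-(1 / 2) : ℝ))⁻¹)
        (integrable_const _)
        (by
          filter_upwards [ae_restrict_mem measurableSet_Ioc] with t ht s hs0 hsT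
          have e : ((R : ℂ) * exp (t * I)).re = R * Real.cos t := by
            rw [re_ofReal_mul, exp_ofReal_mul_I_re]
          rw [e, norm_mul, norm_exp_ofReal_mul_I, one_mul]
          have h6 : T ^ (-(1 / 2) : ℝ) ≤ s ^ (-(1 / 2) : ℝ) :=
            Real.rpow_le_rpow_of_nonpos hs0 hsT (by norm_num)
          have h7 : 0 < T ^ (-(1 / 2) : ℝ) := Real.rpow_pos_of_pos hT _
          have h8 : 1 ≤ (T ^ (-(1 / 2) : ℝ))⁻¹ * s ^ (-(1 / 2) : ℝ) := by
            rw [inv_mul_eq_div, one_le_div h7]; exact h6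
          calc _ ≤ (K * R⁻¹) * Real.exp (T * R) :=
                mul_le_mul (hgb R t le_rfl ht.1.le ht.2) (hexpb s t hs0 hsT) (Real.exp_nonneg _)
                (by positivity)
            _ ≤ (K * R⁻¹) * Real.exp (T * R) * ((T ^ (-(1 / 2) : ℝ))⁻¹ * s ^ (-(1 / 2) : ℝ)) :=
                le_mul_of_one_le_right (by positivity) h8
            _ = _ := by ring)
        (by
          filter_upwards [ae_restrict_mem measurableSet_Ioc] with t ht
          exact (inv_bound R t _ hR (ha 0) ht.1.le ht.2).1)
    have lhs : (simpF (n + 1) a T : ℂ) * (2 * Real.pi * I)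
        = ∫ s in Set.Ioc 0 T, exp (-a 0 * (T - s)) *
          contourI R (fun w => g w * exp (s * w)) := by
      rw [simpF_succ n a ha T hT, ← integral_complex_ofReal, ← integral_mul_const]
      apply setIntegral_congr_fun measurableSet_Ioc
      intro s hs
      simp only
      have := ih (fun j => a j.succ) (fun j => ha _) s hs.1
      push_cast
      rw [mul_assoc, this]
      congr 2
      ext w
      simp only [hg]
      ring
    rw [lhs]
    have expand : ∀ s : ℝ, exp (-a 0 * (T - s)) * contourI R (fun w => g w * exp (s * w)) =
        -exp ((-(3 * Real.pi / 4) : ℝ) * I) * (exp (-a 0 * (T - s)) *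
          ∫ r in Set.Ioi R, g (r * exp ((-(3 * Real.pi / 4) : ℝ) * I)) *
            exp (s * (r * exp ((-(3 * Real.pi / 4) : ℝ) * I)))) +
        I * R * (exp (-a 0 * (T - s)) *
          ∫ t in Set.Ioc (-(3 * Real.pi / 4)) (3 * Real.pi / 4),
            exp (t * I) * g (R * exp (t * I)) * exp (s * (R * exp (t * I)))) +
        exp ((3 * Real.pi / 4 : ℝ) * I) * (exp (-a 0 * (T - s)) *
          ∫ r in Set.Ioi R, g (r * exp ((3 * Real.pi / 4 : ℝ) * I)) *
            exp (s * (r * exp ((3 * Real.pi / 4 : ℝ) * I)))) := by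
      intro s
      rw [contourI_eq, intervalIntegral.integral_of_le (by linarith)]
      simp only [mul_assoc]
      ring
    simp only [expand]
    rw [integral_comb _ _ _ _ _ _ _ i1 i2 i3, e1, e2, e3]
    have fin : contourI R (fun w => (∏ j, (w + a j)⁻¹) * exp (T * w) * w⁻¹) =
        contourI R (fun w => f1 w - exp (-a 0 * T) * (g w * (w + a 0)⁻¹)) := by
      rw [hsplit, hvan, mul_zero, sub_zero]
      congr 1
      ext w
      simp only [hf1, hg, Fin.prod_univ_succ]
      ring
    have hfun : (fun w => f1 w - exp (-a 0 * T) * (g w * (w + a 0)⁻¹)) =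
        fun w => g w * ((exp (T * w) - exp (-a 0 * T)) * (w + a 0)⁻¹) := by
      ext w
      simp only [hf1]
      ring
    rw [fin, hfun, contourI_eq, intervalIntegral.integral_of_le (by linarith)]
    simp only [mul_assoc]

open Complex in
lemma contourI_scale (R T : ℝ) (hT : 0 < T) (f : ℂ → ℂ) :
    contourI R f = T * contourI (R / T) (fun w => f (T * w)) := by
  have ray : ∀ θ : ℝ, (∫ r in Set.Ioi R, f (r * exp (θ * I)))
      = T * ∫ r in Set.Ioi (R / T), f (T * (r * exp (θ * I))) := by
    intro θ
    have := integral_comp_mul_left_Ioi (fun r : ℝ => f (r * exp (θ * I))) (R / T) hT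
    rw [mul_div_cancel₀ _ hT.ne'] at this
    have hT' : (T : ℂ) ≠ 0 := by exact_mod_cast hT.ne'
    simp only [ofReal_mul, mul_assoc] at this
    rw [this, real_smul, ofReal_inv, mul_inv_cancel_left₀ hT']
  have hT' : (T : ℂ) ≠ 0 := by exact_mod_cast hT.ne'
  have e : ∀ z : ℂ, (T : ℂ) * (((R / T : ℝ) : ℂ) * z) = R * z := by
    intro z; push_cast; field_simp
  simp only [contourI_eq, ray, e]
  push_cast
  field_simp

theorem stmt_3 (n : ℕ) (hn : 1 ≤ n) (R T : ℝ) (hR : 0 < R) (hT : 0 < T)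
    (a : Fin n → ℝ) (ha : ∀ j, 0 ≤ a j) :
    ((∫ u in simplexD n T, Real.exp (-∑ j, a j * u j)) : ℂ) =
      ((T : ℂ) ^ n / (2 * Real.pi * Complex.I)) *
        contourI R (fun z => (∏ j, (z + (T : ℂ) * (a j : ℂ))⁻¹) * Complex.exp z * z⁻¹) := by
  have hT' : (T : ℂ) ≠ 0 := by exact_mod_cast hT.ne'
  have h := contour_main (R / T) (by positivity) n a ha T hT
  have hpi : (2 * Real.pi * Complex.I : ℂ) ≠ 0 := Complex.two_pi_I_ne_zero
  rw [contourI_scale R T hT]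
  have hf : (fun w : ℂ => (∏ j, ((T : ℂ) * w + (T : ℂ) * (a j : ℂ))⁻¹) * Complex.exp (T * w) *
      ((T : ℂ) * w)⁻¹) = fun w : ℂ => ((T : ℂ) ^ n * T)⁻¹ *
        ((∏ j, (w + a j)⁻¹) * Complex.exp (T * w) * w⁻¹) := by
    ext w
    have : (∏ j, ((T : ℂ) * w + (T : ℂ) * (a j : ℂ))⁻¹) =
        ((T : ℂ) ^ n)⁻¹ * ∏ j, (w + a j)⁻¹ := by
      simp only [← mul_add, mul_inv, Finset.prod_mul_distrib, Finset.prod_const, Finset.card_univ,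
        Fintype.card_fin, inv_pow]
    rw [this, mul_inv, mul_inv]
    ring
  have hc : ∀ (c : ℂ) (f : ℂ → ℂ) (ρ : ℝ), contourI ρ (fun w => c * f w) = c * contourI ρ f := by
    intro c f ρ
    simp only [contourI, integral_const_mul, mul_left_comm _ c, intervalIntegral.integral_const_mul]
    ring
  rw [hf, hc, ← h, integral_complex_ofReal, ← simpF]
  field_simp
end
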